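/- (Inequality (4.1), algebraic form.) Let α > 0 and let q be an integer with 1 ≤ q ≤ n−1. Suppose Q̊(ψ) ≥ α ‖ψ‖² for every traceless symmetric bilinear form ψ on E, and Ric(X,X) ≥ (n−1) α ‖X‖² for every X ∈ E. Then for every alternating q-multilinear map ω : E^q → ℝ, the Weitzenböck quadratic form on q-forms satisfies Q_q(ω) ≥ q(n−q) α ‖ω‖². -/

import Mathlib

open scoped RealInnerProductSpace
open Finset

/-- bilinear form of the second kind -/
def sk {n : ℕ} (r : Fin n → Fin n → Fin n → Fin n → ℝ) (X Y : Fin n → Fin n → ℝ) : ℝ :=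
  ∑ i, ∑ j, ∑ k, ∑ l, r i k l j * X k l * Y i j

section
variable {n : ℕ} (r : Fin n → Fin n → Fin n → Fin n → ℝ)

theorem sum4_swap (f : Fin n → Fin n → Fin n → Fin n → ℝ) :
    ∑ i, ∑ j, ∑ k, ∑ l, f i j k l = ∑ k, ∑ l, ∑ i, ∑ j, f i j k l := by
  calc ∑ i, ∑ j, ∑ k, ∑ l, f i j k l = ∑ i, ∑ k, ∑ j, ∑ l, f i j k l :=
        sum_congr rfl fun i _ => sum_comm
    _ = ∑ k, ∑ i, ∑ j, ∑ l, f i j k l := sum_comm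
    _ = ∑ k, ∑ i, ∑ l, ∑ j, f i j k l :=
        sum_congr rfl fun i _ => sum_congr rfl fun k _ => sum_comm
    _ = _ := sum_congr rfl fun i _ => sum_comm

theorem sum4_tr (f : Fin n → Fin n → Fin n → Fin n → ℝ) :
    ∑ i, ∑ j, ∑ k, ∑ l, f i j k l = ∑ j, ∑ i, ∑ l, ∑ k, f i j k l := by
  rw [sum_comm]
  exact sum_congr rfl fun i _ => sum_congr rfl fun k _ => sum_comm

theorem sk_add_left (X X' Y) : sk r (fun i j => X i j + X' i j) Y = sk r X Y + sk r X' Y := by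
  simp only [sk, ← sum_add_distrib]
  simp only [mul_add, add_mul]

theorem sk_smul_left (c : ℝ) (X Y) : sk r (fun i j => c * X i j) Y = c * sk r X Y := by
  simp only [sk, mul_sum]
  refine sum_congr rfl fun i _ => sum_congr rfl fun j _ => sum_congr rfl fun k _ =>
    sum_congr rfl fun l _ => by ring

variable (h1 : ∀ i j k l, r i j k l = - r j i k l) (h2 : ∀ i j k l, r i j k l = - r i j l k)
  (h3 : ∀ i j k l, r i j k l = r k l i j)

include h1 h2 in
theorem sk_symm (X Y) : sk r X Y = sk r Y X := by
  rw [sk, sum4_swap, sk]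
  refine sum_congr rfl fun i _ => sum_congr rfl fun j _ => sum_congr rfl fun k _ =>
    sum_congr rfl fun l _ => ?_
  rw [h1 k i j l, h2 i k j l]; ring

include h3 h1 h2 in
theorem sk_tr (X Y) : sk r (fun i j => X j i) (fun i j => Y j i) = sk r X Y := by
  rw [sk, sum4_tr, sk]
  refine sum_congr rfl fun i _ => sum_congr rfl fun j _ => sum_congr rfl fun k _ =>
    sum_congr rfl fun l _ => ?_
  rw [h3 j l k i, h1 k i j l, h2 i k j l]; ring

include h1 in
theorem sk_one (Y) : sk r (fun i j => if i = j then 1 else 0) Y =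
    - ∑ i, ∑ j, (∑ m, r m i m j) * Y i j := by
  simp only [sk, mul_ite, mul_one, mul_zero, ite_mul, zero_mul, sum_ite_eq, mem_univ, if_true,
    ← sum_neg_distrib, sum_mul]
  refine sum_congr rfl fun i _ => sum_congr rfl fun j _ => sum_congr rfl fun k _ => ?_
  rw [h1 i k k j]; ring

include h1 h2 h3 in
theorem sk_psi (A : Fin n → Fin n → ℝ) (c : ℝ) :
    sk r (fun i j => (1/2) * (A i j + A j i) + (-c) * (if i = j then 1 else 0))
      (fun i j => (1/2) * (A i j + A j i) + (-c) * (if i = j then 1 else 0)) =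
    1/2 * (sk r A A + sk r (fun i j => A j i) A)
      + 2 * c * (∑ i, ∑ j, (∑ m, r m i m j) * A i j) - c^2 * ∑ i, ∑ m, r m i m i := by
  have hs := sk_symm r h1 h2
  have e1 := sk_tr r h1 h2 h3 A A
  have e2 := hs A (fun i j => A j i)
  have e3 := sk_tr r h1 h2 h3 (fun i j => if i = j then 1 else 0) A
  have e3' : sk r (fun i j => if i = j then 1 else 0) (fun i j => A j i) =
    sk r (fun i j => if i = j then 1 else 0) A := by
    rw [← e3]; congr 1; ext i j; simp [eq_comm]
  have add_right : ∀ X Y Y', sk r X (fun i j => Y i j + Y' i j) = sk r X Y + sk r X Y' := by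
    intro X Y Y'; rw [hs, sk_add_left, hs Y, hs Y']
  have smul_right : ∀ c X Y, sk r X (fun i j => c * Y i j) = c * sk r X Y := by
    intro c X Y; rw [hs, sk_smul_left, hs Y]
  simp only [sk_add_left, sk_smul_left, add_right, smul_right]
  rw [hs A (fun i j => if i = j then 1 else 0), hs _ (fun i j => if i = j then 1 else 0),
    e1, e2, e3', sk_one r h1, sk_one r h1]
  have : ∑ i, ∑ j, (∑ m, r m i m j) * (if i = j then (1:ℝ) else 0) = ∑ i, ∑ m, r m i m i := by
    simp
  rw [this]; ring
end

section
variable {n p : ℕ} (W : (Fin (p+2) → Fin n) → ℝ)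

def GG (i j : Fin n) : ℝ := ∑ K : Fin (p+1) → Fin n,
  W (Fin.cons i K : Fin (p+2) → Fin n) * W (Fin.cons j K : Fin (p+2) → Fin n)
def NN (i j k l : Fin n) : ℝ := ∑ K : Fin p → Fin n,
  W (Fin.cons i (Fin.cons j K : Fin (p+1) → Fin n) : Fin (p+2) → Fin n) *
  W (Fin.cons k (Fin.cons l K : Fin (p+1) → Fin n) : Fin (p+2) → Fin n)
def AA (I : Fin (p+2) → Fin n) (i j : Fin n) : ℝ :=
  ∑ a, if I a = i then W (Function.update I a j) else 0

theorem sum_cons {m : ℕ} (F : (Fin (m+1) → Fin n) → ℝ) :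
    ∑ I, F I = ∑ i, ∑ K : Fin m → Fin n, F (Fin.cons i K) := by
  rw [← (Fin.consEquiv (fun _ : Fin (m+1) => Fin n)).sum_comp, Fintype.sum_prod_type]
  rfl

theorem GG_eq_NN (i j : Fin n) : GG W i j = ∑ k, NN W i k j k := by
  unfold GG NN; rw [sum_cons]

theorem sum_sq : ∑ I, W I ^ 2 = ∑ i, GG W i i := by
  rw [sum_cons]; simp only [GG, sq]

theorem NN_symm (i j k l : Fin n) : NN W i j k l = NN W k l i j := by
  simp only [NN, mul_comm]

variable (hW : ∀ (σ : Equiv.Perm (Fin (p+2))) I, W (I ∘ σ) = (Equiv.Perm.sign σ : ℤ) * W I)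

include hW in
theorem NN_anti (i j k l : Fin n) : NN W i j k l = - NN W j i k l := by
  unfold NN
  rw [← sum_neg_distrib]
  refine sum_congr rfl fun K _ => ?_
  have := hW (Equiv.swap 0 1) (Fin.cons j (Fin.cons i K : Fin (p+1) → Fin n) : Fin (p+2) → Fin n)
  have e : (Fin.cons j (Fin.cons i K : Fin (p+1) → Fin n) : Fin (p+2) → Fin n) ∘ (Equiv.swap 0 1)
     = (Fin.cons i (Fin.cons j K : Fin (p+1) → Fin n) : Fin (p+2) → Fin n) := by
    funext m
    refine Fin.cases ?_ (fun m => Fin.cases ?_ (fun m => ?_) m) m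
    · simp
    · have : (Fin.succ 0 : Fin (p+2)) = 1 := rfl
      rw [Function.comp_apply, this, Equiv.swap_apply_right]; rfl
    · rw [Function.comp_apply, Equiv.swap_apply_of_ne_of_ne]
      · rfl
      · exact Fin.succ_ne_zero _
      · intro h; exact Fin.succ_ne_zero m (Fin.succ_injective _ h)
  rw [e] at this
  rw [this, Equiv.Perm.sign_swap (by simp)]; simp

include hW in
theorem sgn_mul (σ : Equiv.Perm (Fin (p+2))) (I J) : W (I ∘ σ) * W (J ∘ σ) = W I * W J := by
  rw [hW, hW]
  rcases Int.units_eq_one_or (Equiv.Perm.sign σ) with h | h <;> rw [h] <;> simp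

theorem upd_comp (σ : Equiv.Perm (Fin (p+2))) (J : Fin (p+2) → Fin n) (a j) :
    Function.update (J ∘ σ) a j = Function.update J (σ a) j ∘ σ := by
  funext m
  by_cases h : m = a
  · subst h; simp
  · simp [Function.update_of_ne h, Function.update_of_ne (fun h' => h (σ.injective h'))]

theorem sum_perm (σ : Equiv.Perm (Fin (p+2))) (F : (Fin (p+2) → Fin n) → ℝ) :
    ∑ I, F I = ∑ I, F (I ∘ σ) :=
  ((Equiv.arrowCongr σ.symm (Equiv.refl (Fin n))).sum_comp F).symm

include hW in
theorem pair_perm (σ : Equiv.Perm (Fin (p+2))) (a b : Fin (p+2)) (i j k l : Fin n) :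
    ∑ I : Fin (p+2) → Fin n, (if I a = i then W (Function.update I a j) else 0) *
      (if I b = k then W (Function.update I b l) else 0) =
    ∑ I : Fin (p+2) → Fin n, (if I (σ a) = i then W (Function.update I (σ a) j) else 0) *
      (if I (σ b) = k then W (Function.update I (σ b) l) else 0) := by
  rw [sum_perm σ]
  refine sum_congr rfl fun I _ => ?_
  simp only [upd_comp, Function.comp_apply, ite_mul, mul_ite, zero_mul, mul_zero, sgn_mul W hW]

include hW in
theorem diag_red (a : Fin (p+2)) (i j k l : Fin n) :
    ∑ I : Fin (p+2) → Fin n, (if I a = i then W (Function.update I a j) else 0) *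
      (if I a = k then W (Function.update I a l) else 0) = if i = k then GG W j l else 0 := by
  rw [pair_perm W hW (Equiv.swap 0 a), Equiv.swap_apply_right, sum_cons]
  simp only [Fin.cons_zero, Fin.update_cons_zero, ite_mul, mul_ite, zero_mul, mul_zero]
  by_cases h : i = k
  · subst h
    rw [sum_eq_single i]
    · simp [GG]
    · intro b _ hb; simp [hb]
    · simp
  · rw [if_neg h]
    refine sum_eq_zero fun x _ => sum_eq_zero fun K _ => ?_
    by_cases h1 : x = i
    · subst h1; simp [h]
    · simp [h1]

include hW in
theorem off_red (a b : Fin (p+2)) (hab : a ≠ b) (i j k l : Fin n) :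
    ∑ I : Fin (p+2) → Fin n, (if I a = i then W (Function.update I a j) else 0) *
      (if I b = k then W (Function.update I b l) else 0) = NN W j k i l := by
  obtain ⟨σ, h0, h1⟩ : ∃ σ : Equiv.Perm (Fin (p+2)), σ a = 0 ∧ σ b = 1 := by
    refine ⟨(Equiv.swap a 0).trans (Equiv.swap (Equiv.swap a 0 b) 1), ?_, ?_⟩
    · rw [Equiv.trans_apply, Equiv.swap_apply_left, Equiv.swap_apply_of_ne_of_ne]
      · intro h
        have : Equiv.swap a 0 a = Equiv.swap a 0 b := by rw [Equiv.swap_apply_left]; exact h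
        exact hab ((Equiv.swap a 0).injective this)
      · simp
    · simp
  rw [pair_perm W hW σ, h0, h1, sum_cons]
  have h10 : (1 : Fin (p+2)) = Fin.succ 0 := rfl
  rw [sum_eq_single i]
  · rw [sum_cons, sum_eq_single k]
    · simp only [h10, Fin.cons_zero, Fin.update_cons_zero, Fin.cons_succ, if_true,
        ← Fin.cons_update]
      rfl
    · intro x _ hx
      simp only [h10, Fin.cons_zero, Fin.update_cons_zero, Fin.cons_succ, if_neg hx, mul_zero,
        sum_const_zero]
    · simp
  · intro x _ hx
    simp only [Fin.cons_zero, if_neg hx, zero_mul, sum_const_zero]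
  · simp

include hW in
theorem AA_pair (i j k l : Fin n) : ∑ I, AA W I i j * AA W I k l =
    (p+2 : ℝ) * (if i = k then GG W j l else 0) + (p+2 : ℝ) * (p+1) * NN W j k i l := by
  have : ∀ a b : Fin (p+2), ∑ I : Fin (p+2) → Fin n,
      (if I a = i then W (Function.update I a j) else 0) *
      (if I b = k then W (Function.update I b l) else 0) =
      (if a = b then (if i = k then GG W j l else 0) - NN W j k i l else 0) + NN W j k i l := by
    intro a b
    by_cases h : a = b
    · subst h; rw [diag_red W hW]; simp
    · rw [off_red W hW a b h]; simp [h]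
  simp only [AA, sum_mul_sum]
  rw [sum_comm]
  have e : ∀ a : Fin (p+2), ∑ I : Fin (p+2) → Fin n, ∑ b,
      (if I a = i then W (Function.update I a j) else 0) *
      (if I b = k then W (Function.update I b l) else 0) =
      (if i = k then GG W j l else 0) - NN W j k i l + (p+2) * NN W j k i l := by
    intro a
    rw [sum_comm]
    simp only [this, sum_add_distrib]
    simp
  simp only [e]
  simp only [sum_const, card_univ, Fintype.card_fin, nsmul_eq_mul]
  push_cast
  ring

include hW in
theorem AA_W (i j : Fin n) : ∑ I, W I * AA W I i j = (p+2 : ℝ) * GG W i j := by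
  simp only [AA, mul_sum]
  rw [sum_comm]
  have e : ∀ a : Fin (p+2), ∑ I : Fin (p+2) → Fin n,
      W I * (if I a = i then W (Function.update I a j) else 0) = GG W i j := by
    intro a
    rw [sum_perm (Equiv.swap 0 a)]
    simp only [upd_comp, Function.comp_apply, mul_ite, mul_zero, sgn_mul W hW,
      Equiv.swap_apply_right]
    rw [sum_cons, sum_eq_single i]
    · simp [GG]
    · intro x _ hx; simp [hx]
    · simp
  simp only [e, sum_const, card_univ, Fintype.card_fin, nsmul_eq_mul]
  push_cast
  ring

theorem AA_trace (I) : ∑ i, AA W I i i = (p+2 : ℝ) * W I := by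
  simp only [AA]; rw [sum_comm]; simp

variable (r : Fin n → Fin n → Fin n → Fin n → ℝ)
  (h1 : ∀ i j k l, r i j k l = - r j i k l) (h2 : ∀ i j k l, r i j k l = - r i j l k)
  (h3 : ∀ i j k l, r i j k l = r k l i j)
  (h4 : ∀ i j k l, r i j k l + r j k i l + r k i j l = 0)

def TT : ℝ := ∑ i, ∑ j, ∑ k, ∑ l, r i j k l * NN W i k j l
def PP : ℝ := ∑ i, ∑ j, (∑ m, r m i m j) * GG W i j

theorem sum_sk (X Y : (Fin (p+2) → Fin n) → Fin n → Fin n → ℝ)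
    (Z : Fin n → Fin n → Fin n → Fin n → ℝ)
    (h : ∀ i j k l, ∑ I, X I k l * Y I i j = Z i j k l) :
    ∑ I, sk r (X I) (Y I) = ∑ i, ∑ j, ∑ k, ∑ l, r i k l j * Z i j k l := by
  simp only [sk, ← h]
  rw [sum_comm]; refine sum_congr rfl fun i _ => ?_
  rw [sum_comm]; refine sum_congr rfl fun j _ => ?_
  rw [sum_comm]; refine sum_congr rfl fun k _ => ?_
  rw [sum_comm]; refine sum_congr rfl fun l _ => ?_
  rw [mul_sum]; simp only [mul_assoc]

include hW h1 in
theorem skAA : ∑ I, sk r (AA W I) (AA W I) = - ((p+2:ℝ) * (p+1)) * TT W r := by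
  rw [sum_sk r _ _ _ (fun i j k l => AA_pair W hW k l i j)]
  have : TT W r = ∑ i, ∑ j, ∑ k, ∑ l, r i k l j * NN W i l k j := by
    unfold TT
    refine sum_congr rfl fun i _ => ?_
    calc _ = ∑ j, ∑ l, ∑ k, r i j k l * NN W i k j l := sum_congr rfl fun j _ => sum_comm
      _ = _ := sum_comm
  rw [this]
  simp only [mul_sum]
  refine sum_congr rfl fun i _ => sum_congr rfl fun j _ => sum_congr rfl fun k _ =>
    sum_congr rfl fun l _ => ?_
  rw [NN_anti W hW l i]
  by_cases h : k = i
  · subst h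
    have : r k k l j = 0 := by have := h1 k k l j; linarith
    rw [this]; ring
  · rw [if_neg h]; ring

include hW h2 h4 in
theorem UU : ∑ i, ∑ j, ∑ k, ∑ l, r i j k l * NN W i j k l = 2 * TT W r := by
  have a1 : ∑ i, ∑ j, ∑ k, ∑ l, r j k i l * NN W i j k l = - TT W r := by
    calc _ = ∑ j, ∑ i, ∑ k, ∑ l, r j k i l * NN W i j k l := sum_comm
      _ = ∑ j, ∑ k, ∑ i, ∑ l, r j k i l * NN W i j k l := sum_congr rfl fun j _ => sum_comm
      _ = _ := by
        simp only [TT, ← sum_neg_distrib]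
        refine sum_congr rfl fun i _ => sum_congr rfl fun j _ => sum_congr rfl fun k _ =>
          sum_congr rfl fun l _ => ?_
        rw [NN_anti W hW k i]; ring
  have a2 : ∑ i, ∑ j, ∑ k, ∑ l, r k i j l * NN W i j k l = - TT W r := by
    calc _ = ∑ i, ∑ k, ∑ j, ∑ l, r k i j l * NN W i j k l := sum_congr rfl fun j _ => sum_comm
      _ = ∑ k, ∑ i, ∑ j, ∑ l, r k i j l * NN W i j k l := sum_comm
      _ = ∑ k, ∑ i, ∑ l, ∑ j, r k i j l * NN W i j k l :=
        sum_congr rfl fun j _ => sum_congr rfl fun j _ => sum_comm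
      _ = _ := by
        simp only [TT, ← sum_neg_distrib]
        refine sum_congr rfl fun i _ => sum_congr rfl fun j _ => sum_congr rfl fun k _ =>
          sum_congr rfl fun l _ => ?_
        rw [NN_symm W i k, h2]; ring
  have : ∑ i, ∑ j, ∑ k, ∑ l, r i j k l * NN W i j k l
     + ∑ i, ∑ j, ∑ k, ∑ l, r j k i l * NN W i j k l
     + ∑ i, ∑ j, ∑ k, ∑ l, r k i j l * NN W i j k l = 0 := by
    simp only [← sum_add_distrib, ← add_mul, h4, zero_mul, sum_const_zero]
  linarith

include hW h2 h4 in
theorem skAAt : ∑ I, sk r (fun i j => AA W I j i) (AA W I) =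
    (p+2:ℝ) * PP W r - 2 * ((p+2:ℝ) * (p+1)) * TT W r := by
  rw [sum_sk r _ _ _ (fun i j k l => AA_pair W hW l k i j)]
  have hU : 2 * TT W r = ∑ i, ∑ j, ∑ k, ∑ l, r i k l j * NN W i k l j := by
    rw [← UU W hW r h2 h4]
    refine sum_congr rfl fun i _ => ?_
    calc _ = ∑ j, ∑ l, ∑ k, r i j k l * NN W i j k l := sum_congr rfl fun j _ => sum_comm
      _ = _ := sum_comm
  have hP : PP W r = ∑ i, ∑ j, ∑ k, ∑ l, r i k l j * (if l = i then GG W k j else 0) := by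
    simp only [PP, mul_ite, mul_zero, sum_ite_eq', mem_univ, if_true, sum_mul]
    calc _ = ∑ i, ∑ m, ∑ j, r m i m j * GG W i j := sum_congr rfl fun j _ => sum_comm
      _ = ∑ m, ∑ i, ∑ j, r m i m j * GG W i j := sum_comm
      _ = _ := sum_congr rfl fun j _ => sum_comm
  rw [mul_comm 2, mul_assoc, hU, hP]
  simp only [mul_sum, ← sum_sub_distrib]
  refine sum_congr rfl fun i _ => sum_congr rfl fun j _ => sum_congr rfl fun k _ =>
    sum_congr rfl fun l _ => ?_
  rw [NN_anti W hW k i]; ring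

include hW h1 h2 h3 h4 in
theorem core (hp : p + 2 ≤ n)
    (hQ : ∀ ψ : Fin n → Fin n → ℝ, (∀ i j, ψ i j = ψ j i) → ∑ i, ψ i i = 0 → 0 ≤ sk r ψ ψ)
    (hric : ∀ x : Fin n → ℝ, 0 ≤ ∑ i, ∑ j, (∑ m, r m i m j) * x i * x j) :
    0 ≤ (p+2 : ℝ) * PP W r - (p+2 : ℝ) * (p+1) / 2 * TT W r := by
  have hn : (0:ℝ) < n := by exact_mod_cast (by omega : 0 < n)
  have hP : 0 ≤ PP W r := by
    have : PP W r = ∑ K : Fin (p+1) → Fin n, ∑ i, ∑ j, (∑ m, r m i m j) *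
        W (Fin.cons i K : Fin (p+2) → Fin n) * W (Fin.cons j K : Fin (p+2) → Fin n) := by
      rw [sum_comm]
      refine sum_congr rfl fun i _ => ?_
      rw [sum_comm]
      refine sum_congr rfl fun j _ => ?_
      rw [GG, mul_sum]; simp only [mul_assoc]
    rw [this]
    exact sum_nonneg fun K _ => hric (fun i => W (Fin.cons i K : Fin (p+2) → Fin n))
  have hS : 0 ≤ ∑ i, ∑ m, r m i m i := by
    refine sum_nonneg fun i _ => ?_
    have := hric (fun j => if j = i then 1 else 0)
    simpa using this
  have key : 0 ≤ ∑ I, sk r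
      (fun i j => (1/2) * (AA W I i j + AA W I j i) + (-((p+2)/n * W I)) * (if i = j then 1 else 0))
      (fun i j => (1/2) * (AA W I i j + AA W I j i)
        + (-((p+2)/n * W I)) * (if i = j then 1 else 0)) := by
    refine sum_nonneg fun I _ => hQ _ ?_ ?_
    · intro i j; simp only [eq_comm]; ring
    · have := AA_trace W I
      simp only [if_true, sum_add_distrib, ← mul_sum, this]
      simp
      field_simp
      ring
  have e2 : ∑ I, 2 * ((p+2)/n * W I) * (∑ i, ∑ j, (∑ m, r m i m j) * AA W I i j) =
      2 * ((p+2)/n) * ((p+2) * PP W r) := by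
    simp only [PP, mul_sum (s := (univ : Finset (Fin n))) (a := ((p:ℝ)+2))]
    calc _ = 2 * (((p:ℝ)+2)/n) * ∑ I, ∑ i, ∑ j, (∑ m, r m i m j) * (W I * AA W I i j) := by
          rw [mul_sum]; refine sum_congr rfl fun I _ => ?_
          rw [mul_sum, mul_sum]; refine sum_congr rfl fun i _ => ?_
          rw [mul_sum, mul_sum]; refine sum_congr rfl fun j _ => ?_
          ring
      _ = _ := by
          congr 1
          rw [sum_comm]; refine sum_congr rfl fun i _ => ?_
          rw [sum_comm]; refine sum_congr rfl fun j _ => ?_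
          rw [← mul_sum, AA_W W hW]; ring
  simp only [sk_psi r h1 h2 h3] at key
  rw [sum_sub_distrib, sum_add_distrib, ← mul_sum, sum_add_distrib, skAA W hW r h1,
    skAAt W hW r h2 h4, e2, ← sum_mul] at key
  have h5 : 0 ≤ (∑ I, ((p+2)/n * W I)^2) * ∑ i, ∑ m, r m i m i :=
    mul_nonneg (sum_nonneg fun I _ => sq_nonneg _) hS
  have h6 : ((p:ℝ)+2)/n ≤ 1 := by
    rw [div_le_one hn]; exact_mod_cast hp
  have h7 : 0 ≤ (1 - ((p:ℝ)+2)/n) * ((p+2) * PP W r) :=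
    mul_nonneg (by linarith) (by positivity)
  have h8 : 0 ≤ ((p:ℝ)+2) * PP W r := by positivity
  linarith
end

def dd {n : ℕ} (i j : Fin n) : ℝ := if i = j then 1 else 0

theorem ric_shift {n : ℕ} (r : Fin n → Fin n → Fin n → Fin n → ℝ) (α : ℝ) (i j : Fin n) :
    ∑ m, (r m i m j - α * (dd m m * dd i j - dd m j * dd i m)) =
      ∑ m, r m i m j - α * ((n:ℝ) - 1) * dd i j := by
  rw [sum_sub_distrib, ← mul_sum, sum_sub_distrib]
  have h1 : ∑ m : Fin n, dd m m * dd i j = n * dd i j := by simp [dd]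
  have h2 : ∑ m, dd m j * dd i m = dd i j := by simp [dd]
  rw [h1, h2]; ring

theorem sk_shift {n : ℕ} (r : Fin n → Fin n → Fin n → Fin n → ℝ) (α : ℝ) (ψ : Fin n → Fin n → ℝ) :
    sk (fun i j k l => r i j k l - α * (dd i k * dd j l - dd i l * dd j k)) ψ ψ =
      sk r ψ ψ - α * (∑ i, ∑ j, ψ i j * ψ j i - (∑ i, ψ i i) ^ 2) := by
  have e : sk (fun i j k l => r i j k l - α * (dd i k * dd j l - dd i l * dd j k)) ψ ψ =
      sk r ψ ψ - α * ((∑ i, ∑ j, ∑ k, ∑ l, dd i l * dd k j * ψ k l * ψ i j)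
       - (∑ i, ∑ j, ∑ k, ∑ l, dd i j * dd k l * ψ k l * ψ i j)) := by
    simp only [sk, mul_sum, mul_sub, ← sum_sub_distrib]
    refine sum_congr rfl fun i _ => sum_congr rfl fun j _ => sum_congr rfl fun k _ =>
      sum_congr rfl fun l _ => by ring
  rw [e]
  congr 2
  congr 1
  · refine sum_congr rfl fun i _ => sum_congr rfl fun j _ => ?_
    simp [dd, mul_comm]
  · simp [dd, sq, sum_mul_sum, mul_comm]

theorem PP_shift {n p : ℕ} (W : (Fin (p+2) → Fin n) → ℝ)
    (r : Fin n → Fin n → Fin n → Fin n → ℝ) (α : ℝ) :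
    PP W (fun i j k l => r i j k l - α * (dd i k * dd j l - dd i l * dd j k)) =
      PP W r - α * ((n:ℝ) - 1) * ∑ i, GG W i i := by
  simp only [PP, ric_shift]
  simp only [sub_mul, sum_sub_distrib, mul_sum]
  congr 1
  refine sum_congr rfl fun i _ => ?_
  simp [dd]

theorem TT_shift {n p : ℕ} (W : (Fin (p+2) → Fin n) → ℝ)
    (hW : ∀ (σ : Equiv.Perm (Fin (p+2))) I, W (I ∘ σ) = (Equiv.Perm.sign σ : ℤ) * W I)
    (r : Fin n → Fin n → Fin n → Fin n → ℝ) (α : ℝ) :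
    TT W (fun i j k l => r i j k l - α * (dd i k * dd j l - dd i l * dd j k)) =
      TT W r - α * ∑ i, GG W i i := by
  have e : TT W (fun i j k l => r i j k l - α * (dd i k * dd j l - dd i l * dd j k)) =
      TT W r - α * ((∑ i, ∑ j, ∑ k, ∑ l, dd i k * dd j l * NN W i k j l)
       - (∑ i, ∑ j, ∑ k, ∑ l, dd i l * dd j k * NN W i k j l)) := by
    simp only [TT, mul_sum, mul_sub, ← sum_sub_distrib]
    refine sum_congr rfl fun i _ => sum_congr rfl fun j _ => sum_congr rfl fun k _ =>
      sum_congr rfl fun l _ => by ring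
  have z : ∀ i k l, NN W i i k l = 0 := by
    intro i k l; have := NN_anti W hW i i k l; linarith
  have t1 : ∑ i, ∑ j, ∑ k, ∑ l, dd i k * dd j l * NN W i k j l = 0 := by
    simp [dd, z]
  have t2 : ∑ i, ∑ j, ∑ k, ∑ l, dd i l * dd j k * NN W i k j l = - ∑ i, GG W i i := by
    simp only [GG_eq_NN, ← sum_neg_distrib]
    refine sum_congr rfl fun i _ => sum_congr rfl fun j _ => ?_
    rw [show NN W i j i j = - NN W j i i j from NN_anti W hW i j i j, NN_symm W j i]
    simp [dd, NN_symm W i j]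
  rw [e, t1, t2]; ring



/-- **inequality (4.1), algebraic form.** Let `α > 0` and let `q` be an
integer with `1 ≤ q ≤ n − 1`.  If `Q̊(ψ) ≥ α ‖ψ‖²` for every traceless symmetric
bilinear form `ψ` and `Ric(X,X) ≥ (n−1) α ‖X‖²` for every `X`, then for every
alternating `q`-multilinear map `ω : E^q → ℝ`, the Weitzenböck quadratic form
`Q_q(ω) = q Σ Ric(e_i,e_j) ω(e_i,e_{k₂},…) ω(e_j,e_{k₂},…)
  − (q(q−1)/2) Σ R(e_i,e_j,e_k,e_l) ω(e_i,e_k,e_{k₃},…) ω(e_j,e_l,e_{k₃},…)`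
satisfies `Q_q(ω) ≥ q(n−q) α ‖ω‖²`.  (The tuple `(e_i, e_{k₂},…,e_{k_q})` is encoded as
the function taking value `e i` in position `0` and `e (ks (m−1))` in position `m ≥ 1`,
and similarly for `(e_i, e_k, e_{k₃},…,e_{k_q})`.) -/
theorem stmt_15
    {E : Type*} [NormedAddCommGroup E] [InnerProductSpace ℝ E]
    {n : ℕ} (hn : 2 ≤ n) (e : OrthonormalBasis (Fin n) ℝ E)
    (R : E →ₗ[ℝ] E →ₗ[ℝ] E →ₗ[ℝ] E →ₗ[ℝ] ℝ)
    (hR1 : ∀ X Y Z W : E, R X Y Z W = - R Y X Z W)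
    (hR2 : ∀ X Y Z W : E, R X Y Z W = - R X Y W Z)
    (hR3 : ∀ X Y Z W : E, R X Y Z W = R Z W X Y)
    (hR4 : ∀ X Y Z W : E, R X Y Z W + R Y Z X W + R Z X Y W = 0)
    (α : ℝ) (hα : 0 < α)
    (q : ℕ) (hq1 : 1 ≤ q) (hq2 : q ≤ n - 1)
    (hQ : ∀ ψ : E →ₗ[ℝ] E →ₗ[ℝ] ℝ, (∀ X Y : E, ψ X Y = ψ Y X) →
      (∑ i, ψ (e i) (e i)) = 0 →
      α * (∑ i, ∑ j, (ψ (e i) (e j)) ^ 2) ≤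
        ∑ i, ∑ j, ∑ k, ∑ l, R (e i) (e k) (e l) (e j) * ψ (e k) (e l) * ψ (e i) (e j))
    (hRic : ∀ X : E, ((n : ℝ) - 1) * α * ‖X‖ ^ 2 ≤ ∑ m, R (e m) X (e m) X)
    (ω : AlternatingMap ℝ E ℝ (Fin q)) :
    (q : ℝ) * ((n : ℝ) - (q : ℝ)) * α *
        (∑ t : Fin q → Fin n, (ω (fun m => e (t m))) ^ 2) ≤
      (q : ℝ) *
          (∑ i, ∑ j, ∑ ks : Fin (q - 1) → Fin n,
            (∑ m, R (e m) (e i) (e m) (e j)) *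
              ω (fun m : Fin q => if h0 : (m : ℕ) = 0 then e i
                  else e (ks ⟨(m : ℕ) - 1, by have := m.isLt; omega⟩)) *
              ω (fun m : Fin q => if h0 : (m : ℕ) = 0 then e j
                  else e (ks ⟨(m : ℕ) - 1, by have := m.isLt; omega⟩)))
        - ((q : ℝ) * ((q : ℝ) - 1) / 2) *
          (∑ i, ∑ j, ∑ k, ∑ l, ∑ ks : Fin (q - 2) → Fin n,
            R (e i) (e j) (e k) (e l) *
              ω (fun m : Fin q => if h0 : (m : ℕ) = 0 then e i
                  else if h1 : (m : ℕ) = 1 then e k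
                  else e (ks ⟨(m : ℕ) - 2, by have := m.isLt; omega⟩)) *
              ω (fun m : Fin q => if h0 : (m : ℕ) = 0 then e j
                  else if h1 : (m : ℕ) = 1 then e l
                  else e (ks ⟨(m : ℕ) - 2, by have := m.isLt; omega⟩))) := by
  classical
  have hric0 : ∀ x : Fin n → ℝ, ((n:ℝ) - 1) * α * ∑ i, x i ^ 2 ≤
      ∑ i, ∑ j, (∑ m, R (e m) (e i) (e m) (e j)) * x i * x j := by
    intro x
    have h := hRic (∑ i, x i • e i)
    have hnorm : ‖∑ i, x i • e i‖ ^ 2 = ∑ i, x i ^ 2 := by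
      rw [← real_inner_self_eq_norm_sq, e.orthonormal.inner_sum]
      simp [sq]
    rw [hnorm] at h
    refine h.trans (le_of_eq ?_)
    simp only [map_sum, map_smul, LinearMap.sum_apply, LinearMap.smul_apply, smul_eq_mul, sum_mul,
      mul_sum]
    rw [sum_comm]
    calc _ = ∑ j, ∑ i, ∑ m, x j * (x i * R (e m) (e i) (e m) (e j)) :=
          sum_congr rfl fun j _ => sum_comm
      _ = ∑ i, ∑ j, ∑ m, x j * (x i * R (e m) (e i) (e m) (e j)) := sum_comm
      _ = _ := sum_congr rfl fun i _ => sum_congr rfl fun j _ => sum_congr rfl fun m _ => by ring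
  obtain rfl | ⟨p, rfl⟩ : q = 1 ∨ ∃ p, q = p + 2 := by
    rcases q with _ | _ | p
    · omega
    · left; rfl
    · right; exact ⟨p, rfl⟩
  · have h := hric0 (fun i => ω (fun _ => e i))
    have e0 : ∀ (ks : Fin (1-1) → Fin n) i, (fun m : Fin 1 => if h0 : (m : ℕ) = 0 then e i
                  else e (ks ⟨(m : ℕ) - 1, by have := m.isLt; omega⟩)) = fun _ => e i := by
      intro ks i; funext m; simp
    simp only [e0]
    have e1 : ∑ t : Fin 1 → Fin n, (ω (fun m => e (t m))) ^ 2 = ∑ i, (ω (fun _ => e i)) ^ 2 := by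
      rw [← (Equiv.funUnique (Fin 1) (Fin n)).symm.sum_comp]
      rfl
    rw [e1]
    simpa using h
  · set W : (Fin (p+2) → Fin n) → ℝ := fun I => ω (fun m => e (I m)) with hWdef
    have hW : ∀ (σ : Equiv.Perm (Fin (p+2))) I, W (I ∘ σ) = (Equiv.Perm.sign σ : ℤ) * W I := by
      intro σ I
      have := ω.map_perm (fun m => e (I m)) σ
      simp only [hWdef]
      rw [show (fun m => e ((I ∘ σ) m)) = (fun m => e (I m)) ∘ σ from rfl, this]
      rcases Int.units_eq_one_or (Equiv.Perm.sign σ) with h | h <;> rw [h] <;> simp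
    have c1 : ∀ (ks : Fin (p+1) → Fin n) i, ω (fun m : Fin (p+2) => if h0 : (m : ℕ) = 0 then e i
                  else e (ks ⟨(m : ℕ) - 1, by have := m.isLt; omega⟩))
        = W (Fin.cons i ks : Fin (p+2) → Fin n) := by
      intro ks i
      simp only [hWdef]; congr 1; funext m
      refine Fin.cases ?_ (fun m => ?_) m <;> simp
    have c2 : ∀ (ks : Fin p → Fin n) i k, ω (fun m : Fin (p+2) => if h0 : (m : ℕ) = 0 then e i
                  else if h1 : (m : ℕ) = 1 then e k
                  else e (ks ⟨(m : ℕ) - 2, by have := m.isLt; omega⟩))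
        = W (Fin.cons i (Fin.cons k ks : Fin (p+1) → Fin n) : Fin (p+2) → Fin n) := by
      intro ks i k
      simp only [hWdef]; congr 1; funext m
      refine Fin.cases ?_ (fun m => Fin.cases ?_ (fun m => ?_) m) m
      · simp
      · simp
      · simp
    set Re : Fin n → Fin n → Fin n → Fin n → ℝ :=
      fun i j k l => R (e i) (e j) (e k) (e l) with hRe
    have g1 : (∑ i, ∑ j, ∑ ks : Fin (p + 2 - 1) → Fin n,
            (∑ m, R (e m) (e i) (e m) (e j)) *
              ω (fun m : Fin (p+2) => if h0 : (m : ℕ) = 0 then e i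
                  else e (ks ⟨(m : ℕ) - 1, by have := m.isLt; omega⟩)) *
              ω (fun m : Fin (p+2) => if h0 : (m : ℕ) = 0 then e j
                  else e (ks ⟨(m : ℕ) - 1, by have := m.isLt; omega⟩))) = PP W Re := by
      unfold PP GG
      refine sum_congr rfl fun i _ => sum_congr rfl fun j _ => ?_
      rw [mul_sum]
      refine sum_congr rfl fun ks _ => ?_
      rw [← c1, ← c1, ← mul_assoc]
    have g2 : (∑ i, ∑ j, ∑ k, ∑ l, ∑ ks : Fin (p + 2 - 2) → Fin n,
            R (e i) (e j) (e k) (e l) *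
              ω (fun m : Fin (p+2) => if h0 : (m : ℕ) = 0 then e i
                  else if h1 : (m : ℕ) = 1 then e k
                  else e (ks ⟨(m : ℕ) - 2, by have := m.isLt; omega⟩)) *
              ω (fun m : Fin (p+2) => if h0 : (m : ℕ) = 0 then e j
                  else if h1 : (m : ℕ) = 1 then e l
                  else e (ks ⟨(m : ℕ) - 2, by have := m.isLt; omega⟩))) = TT W Re := by
      unfold TT NN
      refine sum_congr rfl fun i _ => sum_congr rfl fun j _ => sum_congr rfl fun k _ =>
        sum_congr rfl fun l _ => ?_
      rw [mul_sum]
      refine sum_congr rfl fun ks _ => ?_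
      rw [← c2, ← c2, ← mul_assoc]
    rw [g1, g2, show ∑ t : Fin (p+2) → Fin n, (ω (fun m => e (t m))) ^ 2 = ∑ t, W t ^ 2 from rfl,
      sum_sq]
    have hQ0 : ∀ ψ : Fin n → Fin n → ℝ, (∀ i j, ψ i j = ψ j i) → ∑ i, ψ i i = 0 →
        α * (∑ i, ∑ j, ψ i j ^ 2) ≤ sk Re ψ ψ := by
      intro ψ hs ht
      have hb : ∀ i j, (Matrix.toBilin e.toBasis (Matrix.of ψ)) (e i) (e j) = ψ i j := by
        intro i j
        have := LinearMap.BilinForm.toMatrix_apply e.toBasis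
          (Matrix.toBilin e.toBasis (Matrix.of ψ)) i j
        rw [LinearMap.BilinForm.toMatrix_toBilin] at this
        simpa using this.symm
      have := hQ (Matrix.toBilin e.toBasis (Matrix.of ψ)) ?_ ?_
      · simp only [hb] at this
        exact this
      · intro X Y
        rw [Matrix.toBilin_apply, Matrix.toBilin_apply, sum_comm]
        refine sum_congr rfl fun i _ => sum_congr rfl fun j _ => ?_
        rw [Matrix.of_apply, Matrix.of_apply, hs j i]; ring
      · simpa only [hb] using ht
    have hd : ∀ i j : Fin n, dd i j = dd j i := fun i j => by simp only [dd, eq_comm]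
    have hp : p + 2 ≤ n := by omega
    have := core W hW (fun i j k l => Re i j k l - α * (dd i k * dd j l - dd i l * dd j k))
      (fun i j k l => by simp only [hRe]; rw [hR1]; ring)
      (fun i j k l => by simp only [hRe]; rw [hR2]; ring)
      (fun i j k l => by
        simp only [hRe]; rw [hR3, hd i k, hd j l, hd i l, hd j k]; ring)
      (fun i j k l => by
        have := hR4 (e i) (e j) (e k) (e l)
        simp only [hRe]; rw [hd j i, hd k i, hd k j]; linear_combination this) hp
      (fun ψ hs ht => by
        rw [sk_shift, ht]
        have := hQ0 ψ hs ht
        have h2 : ∑ i, ∑ j, ψ i j * ψ j i = ∑ i, ∑ j, ψ i j ^ 2 := by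
          refine sum_congr rfl fun i _ => sum_congr rfl fun j _ => ?_
          rw [hs j i]; ring
        rw [h2]; linarith)
      (fun x => by
        have := hric0 x
        simp only [ric_shift]
        have e1 : ∑ i, ∑ j, (∑ m, Re m i m j - α * ((n:ℝ) - 1) * dd i j) * x i * x j =
          ∑ i, ∑ j, (∑ m, Re m i m j) * x i * x j - ((n:ℝ) - 1) * α * ∑ i, x i ^ 2 := by
          rw [mul_sum, ← sum_sub_distrib]
          refine sum_congr rfl fun i _ => ?_
          simp only [sub_mul (∑ m, Re m i m _), sub_mul (_ * x i), sub_mul, sum_sub_distrib]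
          simp [dd]; ring
        rw [e1]; linarith)
    rw [TT_shift W hW, PP_shift] at this
    have hG : 0 ≤ ∑ i, GG W i i := by rw [← sum_sq]; exact sum_nonneg fun I _ => sq_nonneg _
    have h9 : 0 ≤ ((p:ℝ)+2) * (p+1) / 2 * α * ∑ i, GG W i i := by positivity
    push_cast
    nlinarith [this, h9]
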